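/- For m+1 ≡ 0 (mod p−1), with p | k and p ∤ hM for all 1 ≤ M ≤ k−1, one has [k]_q^{m+1} S_{m,q}(h, k : q^k) = Σ_{M=1}^{k−1} (−1)^{M−1} [M]_q · T_q(m, (hM)_k, k : q^k), where (hM)_k is the residue of hM in [0,k) and [M]_q = (1−q^M)/(1−q). -/

import Mathlib

open Filter Topology Finset

variable (p : ℕ) [Fact p.Prime]

/-- Riemann sums for the modified `q`-Euler numbers
`E_{n,q} = ∫_{ℤ_p} ((1-q^x)/(1-q))^n q^{-x} dμ_q(x)`
(the factor `q^{-x}` cancels the `q^x` of the measure `(-q)^x`, leaving `(-1)^x`). -/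
noncomputable def modEulerSum (q : ℚ_[p]) (n N : ℕ) : ℚ_[p] :=
  (1 + q) / (1 + q ^ p ^ N) *
    ∑ x ∈ range (p ^ N), ((1 - q ^ x) / (1 - q)) ^ n * (-1 : ℚ_[p]) ^ x

/-- The modified `q`-Euler numbers `E_{n,q}`, as the limit of the Riemann sums. -/
noncomputable def modEuler (q : ℚ_[p]) (n : ℕ) : ℚ_[p] :=
  limUnder atTop (modEulerSum p q n)

/-- `q ^ x` for a `p`-adic integer exponent `x`, as the limit of `q ^ (x mod p^n)`. -/
noncomputable def qpowZ (q : ℚ_[p]) (x : ℤ_[p]) : ℚ_[p] :=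
  limUnder atTop (fun n => q ^ x.appr n)

/-- `q ^ x` for a rational exponent `x` lying in `ℤ_p` (junk value `1` otherwise). -/
noncomputable def qpowQ (q : ℚ_[p]) (x : ℚ) : ℚ_[p] :=
  if h : ‖(x : ℚ_[p])‖ ≤ 1 then qpowZ p q ⟨(x : ℚ_[p]), h⟩ else 1

/-- The `q`-Euler polynomial `E_{m,q}(x) = ∫_{ℤ_p} q^{-t} ((1-q^{x+t})/(1-q))^m dμ_q(t)`,
where `qx` stands for `q ^ x`. -/
noncomputable def qEulerPoly (q : ℚ_[p]) (m : ℕ) (qx : ℚ_[p]) : ℚ_[p] :=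
  limUnder atTop (fun N => (1 + q) / (1 + q ^ p ^ N) *
    ∑ t ∈ range (p ^ N), (q ^ t)⁻¹ * ((1 - qx * q ^ t) / (1 - q)) ^ m * (-q) ^ t)

/-- The Teichmüller character: `ω(a) = lim_n a ^ (p ^ n)`. -/
noncomputable def teich (a : ℕ) : ℚ_[p] :=
  limUnder atTop (fun n => (a : ℚ_[p]) ^ p ^ n)

/-- `u ^ s` for a `p`-adic integer exponent `s`. -/
noncomputable def padPow (u : ℚ_[p]) (s : ℤ_[p]) : ℚ_[p] :=
  limUnder atTop (fun n => u ^ s.appr n)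

/-- The `p`-adic binomial coefficient `C(s, j) = s(s-1)⋯(s-j+1)/j!`. -/
noncomputable def cchoose (s : ℚ_[p]) (j : ℕ) : ℚ_[p] :=
  (∏ i ∈ range j, (s - (i : ℚ_[p]))) / (j.factorial : ℚ_[p])

/-- The `p`-adic interpolating function
`T_q(s, a, N : q^N) = ω(a)⁻¹ ⟨a⟩_q^s ∑_{j≥0} C(s,j) q^{aj} ((1-q^N)/(1-q^a))^j E_{j,q^N}`. -/
noncomputable def Tq (q : ℚ_[p]) (s : ℤ_[p]) (a N : ℕ) : ℚ_[p] :=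
  (teich p a)⁻¹ * padPow p ((teich p a)⁻¹ * ((1 - q ^ a) / (1 - q))) s *
    ∑' j : ℕ, cchoose p (s : ℚ_[p]) j * q ^ (a * j) *
      ((1 - q ^ N) / (1 - q ^ a)) ^ j * modEuler p (q ^ N) j

/-- The `q`-analogue of the higher order Dedekind type DC sums
`S_{m,q}(h, k : q^l) = ∑_{M=1}^{k-1} (-1)^{M-1} ((1-q^M)/(1-q^k)) E_{m,q^l}({hM/k})`. -/
noncomputable def Smq (q : ℚ_[p]) (m h k l : ℕ) : ℚ_[p] :=
  ∑ M ∈ Ico 1 k, (-1 : ℚ_[p]) ^ (M - 1) * ((1 - q ^ M) / (1 - q ^ k)) *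
    qEulerPoly p (q ^ l) m (qpowQ p q ((l : ℚ) * Int.fract ((h * M : ℚ) / k)))

/-- The `p`-adic Dedekind type DC sums
`S_{p,q}(s : h, k : q^k) = ∑_{M=1}^{k-1} ((1-q^M)/(1-q)) (-1)^{M-1} T_q(s, hM, k : q^k)`. -/
noncomputable def Spq (q : ℚ_[p]) (s : ℤ_[p]) (h k : ℕ) : ℚ_[p] :=
  ∑ M ∈ Ico 1 k, ((1 - q ^ M) / (1 - q)) * (-1 : ℚ_[p]) ^ (M - 1) * Tq p q s (h * M) k

/-- The Euler polynomials, via the recurrence `∑_{k<n} C(n,k) E_k(x) + 2 E_n(x) = 2 x^n`. -/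
noncomputable def eulerPoly (n : ℕ) (x : ℚ) : ℚ :=
  x ^ n - 1 / 2 * ∑ k ∈ (Finset.range n).attach, (n.choose k.1 : ℚ) * eulerPoly k.1 x
  termination_by n
  decreasing_by exact Finset.mem_range.mp k.2

/-- The periodic Euler function `Ē_m`, with `Ē_m(x) = E_m(x)` on `[0,1)` and
`Ē_m(x+1) = -Ē_m(x)`. -/
noncomputable def periodicEuler (m : ℕ) (x : ℚ) : ℚ :=
  (-1 : ℚ) ^ ⌊x⌋ * eulerPoly m (Int.fract x)

section Helpers

variable {p}

lemma Padic.natCast_dvd_one_sub_of_norm_lt_one {u : ℚ_[p]} (hu : ‖1 - u‖ < 1) :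
    ∃ v : ℤ_[p], (v : ℚ_[p]) = u ∧ (p : ℤ_[p]) ∣ v - 1 := by
  have hu1 : ‖u‖ ≤ 1 := by
    have h := Padic.nonarchimedean (1 : ℚ_[p]) (-(1 - u))
    rw [norm_neg, norm_one, max_eq_left hu.le] at h
    simpa using h
  refine ⟨⟨u, hu1⟩, rfl, ?_⟩
  rw [← PadicInt.norm_lt_one_iff_dvd, PadicInt.norm_def]
  rwa [norm_sub_rev] at hu

lemma Padic.tendsto_pow_prime_pow {u : ℚ_[p]} (hu : ‖1 - u‖ < 1) :
    Tendsto (fun N : ℕ => u ^ p ^ N) atTop (𝓝 1) := by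
  obtain ⟨v, rfl, hv⟩ := Padic.natCast_dvd_one_sub_of_norm_lt_one hu
  rw [tendsto_iff_norm_sub_tendsto_zero]
  have hp1 : ‖(p : ℚ_[p])‖ < 1 := Padic.norm_p_lt_one
  refine squeeze_zero (fun _ => norm_nonneg _) (fun N => ?_)
    (tendsto_pow_atTop_nhds_zero_of_lt_one (norm_nonneg (p : ℚ_[p])) hp1)
  obtain ⟨w, hw⟩ := dvd_sub_pow_of_dvd_sub hv N
  have hw' : (v : ℚ_[p]) ^ p ^ N - 1 = (p : ℚ_[p]) ^ (N + 1) * w := by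
    have := congrArg (fun z : ℤ_[p] => (z : ℚ_[p])) hw
    simpa using this
  rw [hw', norm_mul, norm_pow, pow_succ]
  calc _ ≤ ‖(p : ℚ_[p])‖ ^ N * 1 * 1 := by
        gcongr
        exact w.2
    _ = _ := by ring

lemma Padic.norm_one_sub_pow_lt_one {q : ℚ_[p]} (hq : ‖1 - q‖ < 1) (n : ℕ) :
    ‖1 - q ^ n‖ < 1 := by
  obtain ⟨v, rfl, hv⟩ := Padic.natCast_dvd_one_sub_of_norm_lt_one hq
  have h : (p : ℤ_[p]) ∣ v ^ n - 1 := hv.trans (sub_one_dvd_pow_sub_one v n)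
  rw [← PadicInt.norm_lt_one_iff_dvd, PadicInt.norm_def] at h
  simpa [norm_sub_rev] using h

lemma Padic.norm_natCast_eq_one_of_not_dvd {n : ℕ} (hn : ¬ p ∣ n) : ‖(n : ℚ_[p])‖ = 1 := by
  rw [Padic.norm_natCast_eq_one_iff]
  exact (Nat.Prime.coprime_iff_not_dvd Fact.out).2 hn

lemma Padic.one_add_ne_zero_of_norm_one_sub_lt_one (hp2 : p ≠ 2) {u : ℚ_[p]}
    (hu : ‖1 - u‖ < 1) : 1 + u ≠ 0 := by
  intro h
  have h2 : ‖((2 : ℕ) : ℚ_[p])‖ = 1 := Padic.norm_natCast_eq_one_of_not_dvd fun hd =>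
    hp2 ((Nat.prime_dvd_prime_iff_eq Fact.out Nat.prime_two).1 hd)
  have : 1 - u = ((2 : ℕ) : ℚ_[p]) := by push_cast; linear_combination -h
  rw [this, h2] at hu
  exact lt_irrefl _ hu

lemma Padic.one_sub_pow_ne_zero_of_not_dvd {q : ℚ_[p]} (hq : ‖1 - q‖ < 1) (hq1 : 1 - q ≠ 0)
    {n : ℕ} (hn : ¬ p ∣ n) : 1 - q ^ n ≠ 0 := by
  obtain ⟨v, rfl, hv⟩ := Padic.natCast_dvd_one_sub_of_norm_lt_one hq
  have hv1 : v - 1 ≠ 0 := fun h => hq1 (by rw [sub_eq_zero.1 h]; simp)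
  intro h
  have h0 : v ^ n - 1 = 0 := by
    apply Subtype.ext
    push_cast
    linear_combination -h
  rw [← geom_sum_mul] at h0
  have hs := (mul_eq_zero.1 h0).resolve_right hv1
  have hd : (p : ℤ_[p]) ∣ (∑ i ∈ range n, v ^ i) - n := by
    have : (∑ i ∈ range n, v ^ i) - n = ∑ i ∈ range n, (v ^ i - 1) := by simp
    rw [this]
    exact Finset.dvd_sum fun i _ => hv.trans (sub_one_dvd_pow_sub_one v i)
  rw [hs, zero_sub, dvd_neg, ← PadicInt.norm_lt_one_iff_dvd, PadicInt.norm_natCast_lt_one_iff]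
    at hd
  exact hn hd

lemma Padic.one_sub_pow_prime_ne_zero (hp2 : p ≠ 2) {q : ℚ_[p]} (hq : ‖1 - q‖ < 1)
    (hq1 : 1 - q ≠ 0) : 1 - q ^ p ≠ 0 := by
  have hp : p.Prime := Fact.out
  obtain ⟨v, rfl, hv⟩ := Padic.natCast_dvd_one_sub_of_norm_lt_one hq
  have hv1 : v - 1 ≠ 0 := fun h => hq1 (by rw [sub_eq_zero.1 h]; simp)
  intro h
  have h0 : v ^ p - 1 = 0 := by
    apply Subtype.ext
    push_cast
    linear_combination -h
  rw [← geom_sum_mul] at h0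
  have hs := (mul_eq_zero.1 h0).resolve_right hv1
  obtain ⟨b, hb⟩ := hv
  have hd := odd_sq_dvd_geom_sum₂_sub (a := (1 : ℤ_[p])) b (hp.odd_of_ne_two hp2)
  rw [← hb] at hd
  simp only [one_pow, mul_one, add_sub_cancel, hs, zero_sub, dvd_neg] at hd
  have hp0 : (p : ℤ_[p]) ≠ 0 := by exact_mod_cast hp.ne_zero
  have : (p : ℤ_[p]) ∣ 1 := by
    rw [← mul_dvd_mul_iff_left hp0]
    simpa [pow_two] using hd
  exact PadicInt.prime_p.not_dvd_one this

lemma PadicInt.appr_natCast (a : ℕ) :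
    ∀ᶠ n in atTop, (a : ℤ_[p]).appr n = a := by
  have hp : p.Prime := Fact.out
  filter_upwards [eventually_ge_atTop a] with n hn
  have han : a < p ^ n := hn.trans_lt (Nat.lt_pow_self hp.one_lt)
  have h := Ideal.mem_span_singleton.1 (PadicInt.appr_spec n (a : ℤ_[p]))
  have h' : ((p ^ n : ℕ) : ℤ) ∣ (a : ℤ) - ((a : ℤ_[p]).appr n : ℤ) := by
    have := (PadicInt.pow_p_dvd_int_iff n ((a : ℤ) - ((a : ℤ_[p]).appr n : ℤ))).1
      (by push_cast; exact h)
    simpa using this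
  have hmod := (Nat.modEq_iff_dvd).2 h'
  exact Nat.ModEq.eq_of_lt_of_lt hmod (PadicInt.appr_lt _ n) han

lemma qpowQ_natCast (q : ℚ_[p]) (a : ℕ) : qpowQ p q (a : ℚ) = q ^ a := by
  have h : ‖(((a : ℚ) : ℚ_[p]))‖ ≤ 1 := by
    simpa only [PadicInt.norm_def, PadicInt.coe_natCast, Rat.cast_natCast] using
      PadicInt.norm_le_one (a : ℤ_[p])
  have he : (⟨((a : ℚ) : ℚ_[p]), h⟩ : ℤ_[p]) = (a : ℤ_[p]) := by
    apply Subtype.ext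
    simp
  rw [qpowQ, dif_pos h, he, qpowZ]
  refine Tendsto.limUnder_eq (tendsto_const_nhds.congr' ?_)
  filter_upwards [PadicInt.appr_natCast (p := p) a] with n hn
  rw [hn]

lemma padPow_natCast (u : ℚ_[p]) (m : ℕ) : padPow p u (m : ℤ_[p]) = u ^ m := by
  refine Tendsto.limUnder_eq (tendsto_const_nhds.congr' ?_)
  filter_upwards [PadicInt.appr_natCast (p := p) m] with n hn
  rw [hn]

lemma cchoose_natCast (m j : ℕ) : cchoose p (m : ℚ_[p]) j = m.choose j := by
  rw [cchoose, ← descPochhammer_eval_eq_prod_range, descPochhammer_eval_eq_descFactorial,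
    div_eq_iff (by exact_mod_cast j.factorial_ne_zero), Nat.descFactorial_eq_factorial_mul_choose]
  push_cast
  ring

lemma teich_pow_eq_one {a : ℕ} (ha : ¬ p ∣ a) : teich p a ^ (p - 1) = 1 := by
  have hp : p.Prime := Fact.out
  have hu : ‖1 - (a : ℚ_[p]) ^ (p - 1)‖ < 1 := by
    have h : (p : ℤ) ∣ 1 - (a : ℤ) ^ (p - 1) := by
      have h1 : IsCoprime (a : ℤ) p := by
        rw [Nat.isCoprime_iff_coprime]
        exact ((Nat.Prime.coprime_iff_not_dvd hp).2 ha).symm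
      exact (Int.ModEq.pow_card_sub_one_eq_one hp h1).dvd
    have := (Padic.norm_intCast_lt_one_iff (p := p)).2 h
    simpa using this
  have hlim := Padic.tendsto_pow_prime_pow hu
  have hc : CauchySeq (fun n : ℕ => (a : ℚ_[p]) ^ p ^ n) := by
    apply NonarchimedeanAddGroup.cauchySeq_of_tendsto_sub_nhds_zero
    have hbd : Tendsto (fun n : ℕ => (((a : ℚ_[p]) ^ (p - 1)) ^ p ^ n - 1)) atTop (𝓝 0) := by
      simpa using hlim.sub_const 1
    refine squeeze_zero_norm (fun n => ?_) (tendsto_zero_iff_norm_tendsto_zero.1 hbd)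
    have he : (a : ℚ_[p]) ^ p ^ (n + 1) - (a : ℚ_[p]) ^ p ^ n =
        (a : ℚ_[p]) ^ p ^ n * (((a : ℚ_[p]) ^ (p - 1)) ^ p ^ n - 1) := by
      rw [mul_sub, mul_one, ← pow_mul, ← pow_add]
      congr 2
      obtain ⟨r, rfl⟩ := Nat.exists_eq_add_of_le hp.one_le
      simp only [add_tsub_cancel_left]
      ring
    rw [he, norm_mul, norm_pow, Padic.norm_natCast_eq_one_of_not_dvd ha, one_pow, one_mul]
  obtain ⟨w, hw⟩ := cauchySeq_tendsto_of_complete hc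
  have hwt : teich p a = w := hw.limUnder_eq
  rw [hwt]
  refine tendsto_nhds_unique (hw.pow (p - 1)) (hlim.congr fun n => ?_)
  rw [← pow_mul, ← pow_mul, mul_comm]

lemma tendsto_modEulerSum (hp2 : p ≠ 2) {q : ℚ_[p]} (hq : ‖1 - q‖ < 1) (n : ℕ) :
    Tendsto (modEulerSum p q n) atTop (𝓝 (modEuler p q n)) := by
  have hp : p.Prime := Fact.out
  refine tendsto_nhds_limUnder ?_
  have hgeom (l N : ℕ) : ∑ x ∈ range (p ^ N), (-(q ^ l)) ^ x =
      (1 + (q ^ p ^ N) ^ l) / (1 + q ^ l) := by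
    have h := Padic.one_add_ne_zero_of_norm_one_sub_lt_one hp2 (Padic.norm_one_sub_pow_lt_one hq l)
    rw [eq_div_iff h]
    have := mul_neg_geom_sum (-(q ^ l)) (p ^ N)
    rw [((hp.odd_of_ne_two hp2).pow).neg_pow, ← pow_mul, mul_comm l, pow_mul] at this
    linear_combination this
  have hform (N : ℕ) : modEulerSum p q n N = (1 + q) / (1 + q ^ p ^ N) *
      ∑ l ∈ range (n + 1), (n.choose l : ℚ_[p]) * (-1) ^ l / (1 - q) ^ n *
        ((1 + (q ^ p ^ N) ^ l) / (1 + q ^ l)) := by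
    rw [modEulerSum]
    congr 1
    simp_rw [← hgeom, mul_sum]
    rw [sum_comm]
    refine sum_congr rfl fun x _ => ?_
    rw [div_pow, sub_eq_neg_add, add_pow, sum_div, sum_mul]
    refine sum_congr rfl fun l _ => ?_
    rw [neg_pow (q ^ x), neg_pow (q ^ l), ← pow_mul, ← pow_mul, mul_comm x l]
    ring
  have hq' := Padic.tendsto_pow_prime_pow hq
  refine ⟨_, Tendsto.congr (fun N => (hform N).symm) (Tendsto.mul (tendsto_const_nhds.div
    (tendsto_const_nhds.add hq') ?_) (tendsto_finsetSum _ fun l _ =>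
      tendsto_const_nhds.mul ((tendsto_const_nhds.add (hq'.pow l)).div_const _)))⟩
  exact Padic.one_add_ne_zero_of_norm_one_sub_lt_one hp2 (by simp)

lemma qEulerPoly_eq_sum_modEuler (hp2 : p ≠ 2) {q : ℚ_[p]} (hq : ‖1 - q‖ < 1) (m : ℕ)
    (y : ℚ_[p]) :
    qEulerPoly p q m y = ∑ j ∈ range (m + 1),
      (m.choose j : ℚ_[p]) * ((1 - y) / (1 - q)) ^ (m - j) * y ^ j * modEuler p q j := by
  have hq0 : q ≠ 0 := by
    rintro rfl
    simp at hq
  refine Tendsto.limUnder_eq (Tendsto.congr (fun N => ?_) (tendsto_finsetSum _ fun j _ =>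
    (tendsto_modEulerSum hp2 hq j).const_mul _))
  simp_rw [modEulerSum, mul_sum]
  rw [sum_comm]
  refine sum_congr rfl fun t _ => ?_
  have h1 : (1 - y * q ^ t) / (1 - q) = y * ((1 - q ^ t) / (1 - q)) + (1 - y) / (1 - q) := by
    ring
  rw [h1, add_pow, neg_pow q, mul_sum, sum_mul, mul_sum]
  refine sum_congr rfl fun j _ => ?_
  rw [mul_pow]
  field_simp

lemma Tq_natCast_eq_sum_modEuler (q : ℚ_[p]) {m : ℕ} (hm : (p - 1) ∣ (m + 1)) {a : ℕ}
    (ha : ¬ p ∣ a) (N : ℕ) :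
    Tq p q (m : ℤ_[p]) a N = ((1 - q ^ a) / (1 - q)) ^ m * ∑ j ∈ range (m + 1),
      (m.choose j : ℚ_[p]) * q ^ (a * j) * ((1 - q ^ N) / (1 - q ^ a)) ^ j *
        modEuler p (q ^ N) j := by
  have ht : (teich p a)⁻¹ * (teich p a)⁻¹ ^ m = 1 := by
    obtain ⟨c, hc⟩ := hm
    rw [← pow_succ', hc, inv_pow, pow_mul, teich_pow_eq_one ha, one_pow, inv_one]
  rw [Tq, padPow_natCast, PadicInt.coe_natCast, tsum_eq_sum (s := range (m + 1))]
  · simp_rw [cchoose_natCast]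
    rw [mul_pow, ← mul_assoc, ht, one_mul]
  · intro j hj
    rw [cchoose_natCast, Nat.choose_eq_zero_of_lt (by simpa using hj)]
    simp

end Helpers

/-- For `m + 1 ≡ 0 (mod p-1)`, `p ∣ k` and `p ∤ hM` for `1 ≤ M ≤ k-1`:
`[k]_q^{m+1} S_{m,q}(h,k:q^k) = ∑_{M=1}^{k-1} (-1)^{M-1} [M]_q T_q(m, (hM)_k, k : q^k)`. -/
theorem Smq_eq_Tq_sum (hp2 : p ≠ 2) (q : ℚ_[p]) (hq : ‖1 - q‖ < 1)
    (h k : ℕ) (hh : 0 < h) (hpk : p ∣ k) (hM : ∀ M ∈ Ico 1 k, ¬ p ∣ (h * M))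
    (m : ℕ) (hm : (p - 1) ∣ (m + 1)) :
    ((1 - q ^ k) / (1 - q)) ^ (m + 1) * Smq p q m h k k =
      ∑ M ∈ Ico 1 k, (-1 : ℚ_[p]) ^ (M - 1) * ((1 - q ^ M) / (1 - q)) *
        Tq p q (m : ℤ_[p]) ((h * M) % k) k := by
  have hp : p.Prime := Fact.out
  obtain ⟨c, rfl⟩ := hpk
  rcases Nat.eq_zero_or_pos c with rfl | hc
  · simp
  have hc1 : c = 1 := by
    by_contra hne
    refine hM p (mem_Ico.2 ⟨hp.one_le, ?_⟩) (Dvd.intro_left h rfl)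
    exact lt_mul_of_one_lt_right hp.pos (by omega)
  subst hc1
  simp only [mul_one] at hM ⊢
  by_cases hq1 : 1 - q = 0
  · simp [hq1]
  have hk := Padic.one_sub_pow_prime_ne_zero hp2 hq hq1
  rw [Smq, mul_sum]
  refine sum_congr rfl fun M hMm => ?_
  have hfract : (p : ℚ) * Int.fract ((h * M : ℚ) / p) = ((h * M % p : ℕ) : ℚ) := by
    have h1 : ((h * M : ℚ) / p) = ((h * M : ℕ) : ℚ) / (p : ℕ) := by push_cast; rfl
    have hp0 : (p : ℚ) ≠ 0 := by exact_mod_cast hp.ne_zero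
    rw [h1, Int.fract_div_natCast_eq_div_natCast_mod]
    field_simp
  have ha : ¬ p ∣ h * M % p := fun hd => hM M hMm ((Nat.dvd_mod_iff dvd_rfl).1 hd)
  have ha0 := Padic.one_sub_pow_ne_zero_of_not_dvd hq hq1 ha
  rw [hfract, qpowQ_natCast,
    qEulerPoly_eq_sum_modEuler hp2 (Padic.norm_one_sub_pow_lt_one hq p),
    Tq_natCast_eq_sum_modEuler q hm ha]
  simp only [mul_sum]
  refine sum_congr rfl fun j hj => ?_
  obtain ⟨d, rfl⟩ := Nat.exists_eq_add_of_le (Nat.lt_succ_iff.1 (mem_range.1 hj))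
  rw [add_tsub_cancel_left, pow_mul]
  simp only [div_pow]
  field_simp
  ring
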